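/- arXiv:1511.01570 — 7 statements merged into one kernel-verified Lean document; each statement's English description precedes it below -/
import Mathlib

section
/- Let X and Y be types and p : X → ℝ≥0∞ a fuzzy predicate with p x ≤ 1 for all x. Post-composition with the pushforward PMF.map (Sum.map Subtype.val id) : PMF ({x : X // p x = 1} ⊕ PUnit) → PMF (X ⊕ PUnit) is a bijection from the set of all functions Y → PMF ({x : X // p x = 1} ⊕ PUnit) to the set {f : Y → PMF (X ⊕ PUnit) | ∀ y : Y, (∑' x : X, f y (Sum.inl x) * p x) + f y (Sum.inr PUnit.unit) = 1}. -/
open scoped ENNReal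

namespace PMF

variable {α β : Type*}

theorem map_apply_apply_of_injective {f : α → β} (hf : Function.Injective f) (q : PMF α) (a : α) :
    q.map f (f a) = q a := by
  rw [map_apply, tsum_eq_single a fun b hb => if_neg fun h => hb (hf h).symm, if_pos rfl]

theorem map_injective {f : α → β} (hf : Function.Injective f) :
    Function.Injective (map f) := by
  intro q r h
  ext a
  rw [← map_apply_apply_of_injective hf q, h, map_apply_apply_of_injective hf]

theorem exists_map_eq_of_support_subset_range {f : α → β} (hf : Function.Injective f) {q : PMF β}
    (hq : q.support ⊆ Set.range f) : ∃ r : PMF α, r.map f = q := by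
  have hsum : ∑' a, q (f a) = 1 := by rw [hf.tsum_eq hq, q.tsum_coe]
  let r : PMF α := ⟨fun a => q (f a), hsum ▸ ENNReal.summable.hasSum⟩
  refine ⟨r, ?_⟩
  ext b
  by_cases hb : b ∈ Set.range f
  · obtain ⟨a, rfl⟩ := hb
    exact map_apply_apply_of_injective hf r a
  · rw [(apply_eq_zero_iff q b).2 fun h => hb (hq h), apply_eq_zero_iff, support_map]
    exact fun h => hb (Set.image_subset_range _ _ h)

theorem tsum_mul_eq_one_iff (q : PMF α) {w : α → ℝ≥0∞} (hw : ∀ a, w a ≤ 1) :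
    ∑' a, q a * w a = 1 ↔ ∀ a ∈ q.support, w a = 1 := by
  have hle : ∀ a, q a * w a ≤ q a := fun a => mul_le_of_le_one_right' (hw a)
  constructor
  · intro h a ha
    by_contra hne
    have hlt : q a * w a < q a := by
      simpa using ENNReal.mul_lt_mul_right ((q.mem_support_iff a).1 ha) (q.apply_ne_top a)
        ((hw a).lt_of_ne hne)
    have := ENNReal.tsum_lt_tsum (by simp [h]) hle hlt
    rw [h, q.tsum_coe] at this
    exact this.false
  · intro h
    rw [← q.tsum_coe]
    refine tsum_congr fun a => ?_
    by_cases ha : a ∈ q.support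
    · rw [h a ha, mul_one]
    · rw [(apply_eq_zero_iff q a).2 ha, zero_mul]

end PMF

theorem range_sumMap_subtypeVal_id {X Z : Type*} (P : X → Prop) :
    Set.range (Sum.map (Subtype.val : {x // P x} → X) (id : Z → Z)) =
      {z | Sum.elim P (fun _ => True) z} := by
  ext (x | z) <;> simp

/-- A subprobability distribution has total weight `1`, counting the base point fully, exactly when
it is supported on the comprehension of the predicate together with the base point. -/
theorem tsum_inl_mul_add_inr_eq_one_iff {X : Type*} {p : X → ℝ≥0∞} (hp : ∀ x, p x ≤ 1)
    (q : PMF (X ⊕ PUnit)) :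
    (∑' x, q (Sum.inl x) * p x) + q (Sum.inr PUnit.unit) = 1 ↔
      q.support ⊆ Set.range (Sum.map (Subtype.val : {x // p x = 1} → X) id) := by
  have hw : ∀ z : X ⊕ PUnit, Sum.elim p (fun _ => 1) z ≤ 1 := by
    rintro (x | _)
    exacts [hp x, le_rfl]
  have hsum : (∑' x, q (Sum.inl x) * p x) + q (Sum.inr PUnit.unit) =
      ∑' z, q z * Sum.elim p (fun _ => 1) z := by
    rw [Summable.tsum_sum ENNReal.summable ENNReal.summable]
    simp [tsum_fintype]
  rw [hsum, q.tsum_mul_eq_one_iff hw, range_sumMap_subtypeVal_id]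
  refine forall₂_congr fun z _ => ?_
  cases z <;> simp

/-- The comprehension adjunction for probabilistic computation: post-composition with the
pushforward along the inclusion `{x // p x = 1} ⊕ PUnit → X ⊕ PUnit` is a bijection from
all probabilistic partial maps into the comprehension of the fuzzy predicate `p` onto the
probabilistic partial maps `f` into `X` satisfying `∑' x, f y (inl x) * p x + f y (inr *) = 1`. -/
theorem stmt5 {X Y : Type*} (p : X → ℝ≥0∞) (hp : ∀ x, p x ≤ 1) :
    Set.BijOn
      (fun (g : Y → PMF ({x : X // p x = 1} ⊕ PUnit)) =>
        fun y : Y => (g y).map (Sum.map Subtype.val id))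
      (Set.univ : Set (Y → PMF ({x : X // p x = 1} ⊕ PUnit)))
      {f : Y → PMF (X ⊕ PUnit) |
        ∀ y : Y,
          (∑' x : X, f y (Sum.inl x) * p x) + f y (Sum.inr PUnit.unit) = 1} := by
  have hinj : Function.Injective (Sum.map (Subtype.val : {x : X // p x = 1} → X)
      (id : PUnit → PUnit)) := Subtype.val_injective.sumMap Function.injective_id
  refine ⟨fun g _ y => ?_, fun g _ g' _ h => ?_, fun f hf => ?_⟩
  · rw [tsum_inl_mul_add_inr_eq_one_iff hp, PMF.support_map]
    exact Set.image_subset_range _ _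
  · exact funext fun y => PMF.map_injective hinj (congrFun h y)
  · choose g hg using fun y => PMF.exists_map_eq_of_support_subset_range hinj
      ((tsum_inl_mul_add_inr_eq_one_iff hp (f y)).1 (hf y))
    exact ⟨g, Set.mem_univ g, funext hg⟩
end

section
/- Let X and Y be types and p : X → ℝ≥0∞ a fuzzy predicate with p x ≤ 1 for all x. The map sending a function g : {x : X // p x ≠ 1} → PMF (Y ⊕ PUnit) to the function ḡ : X → PMF (Y ⊕ PUnit) defined by: if p x = 1 then ḡ x is the point mass at Sum.inr PUnit.unit, and if p x ≠ 1 then ḡ x (Sum.inl y) = (1 - p x) * g ⟨x, _⟩ (Sum.inl y) for all y : Y and ḡ x (Sum.inr PUnit.unit) = p x + (1 - p x) * g ⟨x, _⟩ (Sum.inr PUnit.unit), is a bijection from the set of all functions {x : X // p x ≠ 1} → PMF (Y ⊕ PUnit) onto the set {f : X → PMF (Y ⊕ PUnit) | ∀ x : X, p x ≤ f x (Sum.inr PUnit.unit)}. -/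
open scoped ENNReal

namespace SubPMF

universe u v w

variable {Y : Type u}

theorem tsum_sum_punit (f : Y ⊕ PUnit.{v + 1} → ℝ≥0∞) :
    ∑' z, f z = ∑' y, f (Sum.inl y) + f (Sum.inr PUnit.unit) := by
  rw [ENNReal.summable.tsum_sum ENNReal.summable, tsum_fintype fun b ↦ f (Sum.inr b)]
  simp

theorem tsum_inl_add_inr (f : PMF (Y ⊕ PUnit.{v + 1})) :
    ∑' y, f (Sum.inl y) + f (Sum.inr PUnit.unit) = 1 := by
  rw [← tsum_sum_punit, f.tsum_coe]

/-- The subprobability distribution on `Y` with masses `s y`, the missing mass `r` being placed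
at the base point. -/
def ofMass (s : Y → ℝ≥0∞) (r : ℝ≥0∞) (h : ∑' y, s y + r = 1) : PMF (Y ⊕ PUnit.{v + 1}) :=
  ⟨Sum.elim s fun _ ↦ r, by
    rw [ENNReal.summable.hasSum_iff, tsum_sum_punit]
    exact h⟩

@[simp]
theorem ofMass_inl (s : Y → ℝ≥0∞) (r : ℝ≥0∞) (h : ∑' y, s y + r = 1) (y : Y) :
    (ofMass s r h : PMF (Y ⊕ PUnit.{v + 1})) (Sum.inl y) = s y := rfl

@[simp]
theorem ofMass_inr (s : Y → ℝ≥0∞) (r : ℝ≥0∞) (h : ∑' y, s y + r = 1) :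
    (ofMass s r h : PMF (Y ⊕ PUnit.{v + 1})) (Sum.inr PUnit.unit) = r := rfl

theorem ext_sum_punit {f g : PMF (Y ⊕ PUnit.{v + 1})} (hl : ∀ y, f (Sum.inl y) = g (Sum.inl y))
    (hr : f (Sum.inr PUnit.unit) = g (Sum.inr PUnit.unit)) : f = g := by
  ext (y | ⟨⟩)
  exacts [hl y, hr]

/-- Scale a subprobability distribution by `1 - q`, moving the mass `q` to the base point. -/
noncomputable def damp (q : ℝ≥0∞) (hq : q ≤ 1) (g : PMF (Y ⊕ PUnit.{v + 1})) :
    PMF (Y ⊕ PUnit.{w + 1}) :=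
  ofMass (fun y ↦ (1 - q) * g (Sum.inl y)) (q + (1 - q) * g (Sum.inr PUnit.unit)) <| by
    rw [ENNReal.tsum_mul_left, add_left_comm, ← mul_add, tsum_inl_add_inr, mul_one,
      add_tsub_cancel_of_le hq]

/-- Remove the mass `q` from the base point and renormalize. -/
noncomputable def undamp (q : ℝ≥0∞) (hq : q < 1) (f : PMF (Y ⊕ PUnit.{w + 1}))
    (hf : q ≤ f (Sum.inr PUnit.unit)) : PMF (Y ⊕ PUnit.{v + 1}) :=
  ofMass (fun y ↦ (1 - q)⁻¹ * f (Sum.inl y)) ((1 - q)⁻¹ * (f (Sum.inr PUnit.unit) - q)) <| by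
    rw [ENNReal.tsum_mul_left, ← mul_add, ← AddLECancellable.add_tsub_assoc_of_le
      (ENNReal.cancel_of_ne hq.ne_top) hf, tsum_inl_add_inr]
    exact ENNReal.inv_mul_cancel (tsub_pos_of_lt hq).ne' (by simp)

theorem undamp_damp {q : ℝ≥0∞} (hq : q < 1) (g : PMF (Y ⊕ PUnit.{v + 1}))
    (h : q ≤ (damp q hq.le g : PMF (Y ⊕ PUnit.{w + 1})) (Sum.inr PUnit.unit)) :
    undamp q hq (damp q hq.le g) h = g := by
  have h0 : 1 - q ≠ 0 := (tsub_pos_of_lt hq).ne'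
  have ht : 1 - q ≠ ∞ := by simp
  apply ext_sum_punit
  · intro y
    simp [undamp, damp, ENNReal.inv_mul_cancel_left h0 ht]
  · simp [undamp, damp, ENNReal.add_sub_cancel_left hq.ne_top,
      ENNReal.inv_mul_cancel_left h0 ht]

theorem damp_undamp {q : ℝ≥0∞} (hq : q < 1) (f : PMF (Y ⊕ PUnit.{w + 1}))
    (hf : q ≤ f (Sum.inr PUnit.unit)) :
    damp q hq.le (undamp q hq f hf : PMF (Y ⊕ PUnit.{v + 1})) = f := by
  have h0 : 1 - q ≠ 0 := (tsub_pos_of_lt hq).ne'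
  have ht : 1 - q ≠ ∞ := by simp
  apply ext_sum_punit
  · intro y
    simp [undamp, damp, ENNReal.mul_inv_cancel_left h0 ht]
  · simp [undamp, damp, ENNReal.mul_inv_cancel_left h0 ht, add_tsub_cancel_of_le hf]

theorem eq_pure_of_one_le {f : PMF (Y ⊕ PUnit.{w + 1})} (hf : 1 ≤ f (Sum.inr PUnit.unit)) :
    f = PMF.pure (Sum.inr PUnit.unit) := by
  have h1 : f (Sum.inr PUnit.unit) = 1 := le_antisymm (f.coe_le_one _) hf
  have hs := (f.apply_eq_one_iff _).1 h1
  apply ext_sum_punit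
  · intro y
    have : f (Sum.inl y) = 0 := by simp [f.apply_eq_zero_iff, hs]
    simp [this]
  · simp [h1]

open Classical in
/-- Kleisli maps out of the quotient of a fuzzy predicate `p` correspond to Kleisli maps whose mass
at the base point is at least `p`. -/
noncomputable def quotientEquiv {X : Type*} (p : X → ℝ≥0∞) (hp : ∀ x, p x ≤ 1) :
    ({x : X // p x ≠ 1} → PMF (Y ⊕ PUnit.{v + 1})) ≃
      {f : X → PMF (Y ⊕ PUnit.{w + 1}) | ∀ x : X, p x ≤ f x (Sum.inr PUnit.unit)} where
  toFun g := ⟨fun x ↦ if h : p x ≠ 1 then damp (p x) (hp x) (g ⟨x, h⟩)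
      else PMF.pure (Sum.inr PUnit.unit), fun x ↦ by
    by_cases h : p x = 1
    · simp [h]
    · simp [h, damp]⟩
  invFun f x := undamp (p x) ((hp x).lt_of_ne x.2) (f.1 x) (f.2 x)
  left_inv g := by
    ext1 x
    simp [x.2, undamp_damp]
  right_inv f := by
    ext1
    funext x
    by_cases h : p x = 1
    · simpa [h] using (eq_pure_of_one_le (h ▸ f.2 x)).symm
    · simpa [h] using damp_undamp _ _ (f.2 x)

end SubPMF

/-- The quotient adjunction for probabilistic computation: there is a bijection from all
probabilistic partial maps `g` out of the quotient `{x // p x ≠ 1}` of the fuzzy predicate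
`p` onto the probabilistic partial maps `f : X → PMF (Y ⊕ PUnit)` with
`p x ≤ f x (inr *)` for all `x`, which extends `g` as follows: on points with `p x = 1`
it is the point mass at the base point, and on points with `p x ≠ 1` it takes the value
`(1 - p x) * g ⟨x, _⟩ (inl y)` at `inl y` and `p x + (1 - p x) * g ⟨x, _⟩ (inr *)` at the
base point. -/
theorem stmt6 {X Y : Type*} (p : X → ℝ≥0∞) (hp : ∀ x, p x ≤ 1) :
    ∃ e : ({x : X // p x ≠ 1} → PMF (Y ⊕ PUnit)) ≃
        {f : X → PMF (Y ⊕ PUnit) | ∀ x : X, p x ≤ f x (Sum.inr PUnit.unit)},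
      ∀ (g : {x : X // p x ≠ 1} → PMF (Y ⊕ PUnit)) (x : X),
        (p x = 1 → (e g : X → PMF (Y ⊕ PUnit)) x = PMF.pure (Sum.inr PUnit.unit)) ∧
        ∀ h : p x ≠ 1,
          (∀ y : Y, (e g : X → PMF (Y ⊕ PUnit)) x (Sum.inl y)
              = (1 - p x) * g ⟨x, h⟩ (Sum.inl y)) ∧
          (e g : X → PMF (Y ⊕ PUnit)) x (Sum.inr PUnit.unit)
              = p x + (1 - p x) * g ⟨x, h⟩ (Sum.inr PUnit.unit) := by
  refine ⟨SubPMF.quotientEquiv p hp, fun g x ↦ ⟨fun h ↦ ?_, fun h ↦ ⟨fun y ↦ ?_, ?_⟩⟩⟩ <;>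
    simp [SubPMF.quotientEquiv, SubPMF.damp, h]
end

section
/- Let X and Y be measurable spaces, and let p : X → ℝ≥0∞ be measurable with p x ≤ 1 for all x. Let f be a kernel from X to Y (a measurable family of measures) such that f x Set.univ ≤ 1 - p x for every x : X. Then there exists a unique kernel g from the subtype {x : X // p x ≠ 1} (with the induced σ-algebra) to Y such that f ↑x' = (1 - p ↑x') • g x' for every x' : {x // p x ≠ 1}; moreover this g satisfies g x' Set.univ ≤ 1 for all x'. -/
open scoped ENNReal

/-- The universal property of the quotient adjunction for the subprobability Giry monad:
a subprobability kernel `f` from `X` to `Y` dominated by `1 - p` factors uniquely through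
the quotient `{x // p x ≠ 1}` via a kernel `g` with `f ↑x' = (1 - p ↑x') • g x'`, and this
`g` is again a subprobability kernel. -/
theorem stmt7 {X Y : Type*} [MeasurableSpace X] [MeasurableSpace Y]
    (p : X → ℝ≥0∞) (hp_meas : Measurable p) (hp : ∀ x, p x ≤ 1)
    (f : ProbabilityTheory.Kernel X Y)
    (hf : ∀ x : X, f x Set.univ ≤ 1 - p x) :
    (∃! g : ProbabilityTheory.Kernel {x : X // p x ≠ 1} Y,
        ∀ x' : {x : X // p x ≠ 1}, f ↑x' = (1 - p ↑x') • g x') ∧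
    ∀ g : ProbabilityTheory.Kernel {x : X // p x ≠ 1} Y,
      (∀ x' : {x : X // p x ≠ 1}, f ↑x' = (1 - p ↑x') • g x') →
      ∀ x' : {x : X // p x ≠ 1}, g x' Set.univ ≤ 1 := by
  have h_ne_zero : ∀ x' : {x : X // p x ≠ 1}, 1 - p ↑x' ≠ 0 := fun x' =>
    (tsub_pos_of_lt (lt_of_le_of_ne (hp x') x'.2)).ne'
  have h_ne_top : ∀ x' : {x : X // p x ≠ 1}, 1 - p ↑x' ≠ ∞ := fun x' =>
    ENNReal.sub_ne_top ENNReal.one_ne_top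
  have h_unique : ∀ g : ProbabilityTheory.Kernel {x : X // p x ≠ 1} Y,
      (∀ x' : {x : X // p x ≠ 1}, f ↑x' = (1 - p ↑x') • g x') →
      ∀ x' : {x : X // p x ≠ 1}, g x' = (1 - p ↑x')⁻¹ • f ↑x' := by
    intro g hg x'
    rw [hg x', smul_smul, ENNReal.inv_mul_cancel (h_ne_zero x') (h_ne_top x'), one_smul]
  refine ⟨⟨⟨fun x' => (1 - p ↑x')⁻¹ • f ↑x', ?_⟩, ?_, ?_⟩, ?_⟩
  · refine MeasureTheory.Measure.measurable_of_measurable_coe _ fun s hs => ?_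
    simp only [MeasureTheory.Measure.smul_apply, smul_eq_mul]
    exact ((hp_meas.comp measurable_subtype_coe).const_sub 1).inv.mul
      ((f.measurable_coe hs).comp measurable_subtype_coe)
  · intro x'
    change f ↑x' = (1 - p ↑x') • ((1 - p ↑x')⁻¹ • f ↑x')
    rw [smul_smul, ENNReal.mul_inv_cancel (h_ne_zero x') (h_ne_top x'), one_smul]
  · exact fun g hg => ProbabilityTheory.Kernel.ext (h_unique g hg)
  · intro g hg x'
    rw [h_unique g hg x', MeasureTheory.Measure.smul_apply, smul_eq_mul]
    exact (mul_le_mul_right (hf x') _).trans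
      (ENNReal.inv_mul_cancel (h_ne_zero x') (h_ne_top x')).le
end

section
/- Let A, B, X, Y be commutative rings and f : A →+* X, g : B →+* Y ring homomorphisms. Then in the category CommRingCat of commutative rings, the commuting square with top-left corner A × B, top map RingHom.fst A B : A × B → A, left map the product map f × g : A × B → X × Y (given by (a,b) ↦ (f a, g b)), right map f : A → X, and bottom map RingHom.fst X Y : X × Y → X, is a pushout square. -/
open CategoryTheory

universe u

section

variable {X Y T : Type*} [CommRing X] [CommRing Y] [CommRing T]

theorem RingHom.map_mk_zero_of_map_zero_one (k : X × Y →+* T) (hk : k (0, 1) = 0) (p : X × Y) :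
    k (p.1, 0) = k p := by
  have hp : p = (p.1, 0) + p * (0, 1) := by ext <;> simp
  conv_rhs => rw [hp, map_add, map_mul, hk, mul_zero, add_zero]

/-- A ring homomorphism on `X × Y` killing `(0, 1)` descends along the first projection. -/
def RingHom.descFst (k : X × Y →+* T) (hk : k (0, 1) = 0) : X →+* T where
  toFun x := k (x, 0)
  map_one' := (k.map_mk_zero_of_map_zero_one hk 1).trans (map_one k)
  map_mul' x y := by rw [← map_mul, Prod.mk_mul_mk, mul_zero]
  map_zero' := map_zero k
  map_add' x y := by rw [← map_add, Prod.mk_add_mk, add_zero]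

theorem RingHom.descFst_comp_fst (k : X × Y →+* T) (hk : k (0, 1) = 0) :
    (k.descFst hk).comp (RingHom.fst X Y) = k :=
  RingHom.ext (k.map_mk_zero_of_map_zero_one hk)

end

/-- In `CommRingCat`, the square with top `RingHom.fst A B`, left the product map
`f × g : A × B → X × Y`, right `f`, and bottom `RingHom.fst X Y` is a pushout square. -/
theorem stmt11 {A B X Y : Type u} [CommRing A] [CommRing B] [CommRing X] [CommRing Y]
    (f : A →+* X) (g : B →+* Y) :
    IsPushout (CommRingCat.ofHom (RingHom.fst A B))
      (CommRingCat.ofHom (RingHom.prodMap f g))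
      (CommRingCat.ofHom f)
      (CommRingCat.ofHom (RingHom.fst X Y)) := by
  have hs (s : Limits.PushoutCocone (CommRingCat.ofHom (RingHom.fst A B))
      (CommRingCat.ofHom (RingHom.prodMap f g))) : s.inr.hom (0, 1) = 0 := by
    have h := congr($(s.condition).hom (0, 1))
    simpa using h.symm
  refine IsPushout.of_isColimit' ⟨rfl⟩ (Limits.PushoutCocone.IsColimit.mk _
    (fun s => CommRingCat.ofHom (s.inr.hom.descFst (hs s))) (fun s => ?_) (fun s => ?_)
    (fun s m _ hm => ?_))
  · ext a
    have h := congr($(s.condition).hom (a, 0))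
    simpa [RingHom.descFst] using h.symm
  · exact CommRingCat.hom_ext (RingHom.descFst_comp_fst _ (hs s))
  · ext x
    exact congr($(hm).hom (x, 0))
end

section
/- The opposite category of the category of commutative rings, CommRingCatᵒᵖ, is finitary extensive; moreover it has a terminal object (given by the ring ℤ, which is initial in CommRingCat). -/
open CategoryTheory

namespace RingHom

open Function

/-- Two ring homomorphisms `p`, `q` sending an idempotent `e` to `1` and `0` exhibit their source
as a product if and only if they are the quotient maps by `1 - e` and by `e`. -/
theorem bijective_prod_iff_of_isIdempotentElem {P A B : Type*} [CommRing P] [CommRing A]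
    [CommRing B] (p : P →+* A) (q : P →+* B) {e : P} (he : IsIdempotentElem e)
    (hp : p e = 1) (hq : q e = 0) :
    Bijective (p.prod q) ↔
      (Surjective p ∧ ker p = Ideal.span {1 - e}) ∧ (Surjective q ∧ ker q = Ideal.span {e}) := by
  have he' : e * e = e := he
  constructor
  · rintro ⟨hi, hs⟩
    refine ⟨⟨fun a ↦ ?_, ?_⟩, ⟨fun b ↦ ?_, ?_⟩⟩
    · obtain ⟨x, hx⟩ := hs (a, 0)
      exact ⟨x, congrArg Prod.fst hx⟩
    · refine le_antisymm (fun x hx ↦ ?_) ?_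
      · rw [mem_ker] at hx
        refine Ideal.mem_span_singleton'.mpr ⟨x, hi ?_⟩
        simp [hp, hq, hx]
      · simp [mem_ker, hp]
    · obtain ⟨x, hx⟩ := hs (0, b)
      exact ⟨x, congrArg Prod.snd hx⟩
    · refine le_antisymm (fun x hx ↦ ?_) ?_
      · rw [mem_ker] at hx
        refine Ideal.mem_span_singleton'.mpr ⟨x, hi ?_⟩
        simp [hp, hq, hx]
      · simp [mem_ker, hq]
  · rintro ⟨⟨hps, hpk⟩, ⟨hqs, hqk⟩⟩
    refine ⟨(injective_iff_map_eq_zero _).mpr fun x hx ↦ ?_, fun ⟨a, b⟩ ↦ ?_⟩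
    · have hxp : x ∈ ker p := congrArg Prod.fst hx
      have hxq : x ∈ ker q := congrArg Prod.snd hx
      rw [hpk, Ideal.mem_span_singleton'] at hxp
      rw [hqk, Ideal.mem_span_singleton'] at hxq
      obtain ⟨y, hy⟩ := hxp
      obtain ⟨z, hz⟩ := hxq
      linear_combination (1 - e) * (-hz) - e * hy - (y + z) * he'
    · obtain ⟨x, rfl⟩ := hps a
      obtain ⟨y, rfl⟩ := hqs b
      exact ⟨e * x + (1 - e) * y, by simp [hp, hq]⟩

end RingHom

namespace CommRingCat

open Function Limits

/-- A binary fan of commutative rings is a limit if and only if the induced map to the Cartesian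
product is bijective. -/
theorem nonempty_isLimit_binaryFan_iff {P A B : CommRingCat.{u}} (p : P ⟶ A) (q : P ⟶ B) :
    Nonempty (IsLimit (BinaryFan.mk p q)) ↔ Bijective (p.hom.prod q.hom) := by
  rw [(prodFanIsLimit A B).nonempty_isLimit_iff_isIso_lift,
    ConcreteCategory.isIso_iff_bijective]
  rfl

/-- A commutative square is a pushout as soon as two parallel sides are surjective and the kernel
of one generates the kernel of the other. -/
theorem isPushout_of_surjective_of_ker_eq {R A S T : CommRingCat.{u}} {f : R ⟶ A} {g : R ⟶ S}
    {k : A ⟶ T} {h : S ⟶ T} (comm : f ≫ k = g ≫ h) (hf : Surjective f.hom)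
    (hh : Surjective h.hom) (hker : RingHom.ker h.hom = (RingHom.ker f.hom).map g.hom) :
    IsPushout f g k h := by
  have : Epi f := ConcreteCategory.epi_of_surjective f hf
  have : Epi h := ConcreteCategory.epi_of_surjective h hh
  refine ⟨⟨comm⟩, ⟨PushoutCocone.isColimitAux' _ fun s ↦ ?_⟩⟩
  have hle : RingHom.ker h.hom ≤ RingHom.ker s.inr.hom := by
    rw [hker, Ideal.map_le_iff_le_comap]
    intro x hx
    have hs : s.inl.hom (f.hom x) = s.inr.hom (g.hom x) :=
      ConcreteCategory.congr_hom s.condition x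
    rw [RingHom.mem_ker] at hx
    rw [Ideal.mem_comap, RingHom.mem_ker, ← hs, hx, map_zero]
  let l : T ⟶ s.pt := ofHom (RingHom.liftOfSurjective h.hom hh ⟨s.inr.hom, hle⟩)
  have hl : h ≫ l = s.inr := by
    ext x
    exact RingHom.liftOfRightInverse_comp_apply _ _ (rightInverse_surjInv hh) ⟨s.inr.hom, hle⟩ x
  refine ⟨l, ?_, hl, fun _ hm ↦ ?_⟩
  · change k ≫ l = s.inl
    rw [← cancel_epi f, reassoc_of% comm, hl, s.condition]
  · exact (cancel_epi h).mp (hm.trans hl.symm)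

/-- The pushout of a surjection of commutative rings is the quotient by the extended kernel. -/
theorem isPushout_iff_of_surjective {R A S T : CommRingCat.{u}} {f : R ⟶ A} {g : R ⟶ S}
    {k : A ⟶ T} {h : S ⟶ T} (comm : f ≫ k = g ≫ h) (hf : Surjective f.hom) :
    IsPushout f g k h ↔
      Surjective h.hom ∧ RingHom.ker h.hom = (RingHom.ker f.hom).map g.hom := by
  refine ⟨fun H ↦ ?_, fun ⟨hh, hker⟩ ↦ isPushout_of_surjective_of_ker_eq comm hf hh hker⟩
  let I := (RingHom.ker f.hom).map g.hom
  have hle : RingHom.ker f.hom ≤ RingHom.ker ((Ideal.Quotient.mk I).comp g.hom) := by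
    rw [← RingHom.comap_ker, Ideal.mk_ker]
    exact Ideal.le_comap_map
  let k' : A ⟶ of (S ⧸ I) := ofHom (RingHom.liftOfSurjective f.hom hf ⟨_, hle⟩)
  let h' : S ⟶ of (S ⧸ I) := ofHom (Ideal.Quotient.mk I)
  have H' : IsPushout f g k' h' := by
    refine isPushout_of_surjective_of_ker_eq ?_ hf Ideal.Quotient.mk_surjective Ideal.mk_ker
    ext x
    exact RingHom.liftOfRightInverse_comp_apply _ _ (rightInverse_surjInv hf) ⟨_, hle⟩ x
  let e : of (S ⧸ I) ≅ T := H'.isoIsPushout _ _ H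
  have he : h = h' ≫ e.hom := (H'.inr_isoIsPushout_hom _ _ H).symm
  have hbij : Bijective e.hom.hom := ConcreteCategory.bijective_of_isIso e.hom
  rw [he, hom_comp]
  refine ⟨hbij.surjective.comp Ideal.Quotient.mk_surjective, ?_⟩
  rw [RingHom.ker_comp_of_injective _ hbij.injective]
  exact Ideal.mk_ker

/-- Binary products of commutative rings are co-van Kampen: given a morphism between binary fans
whose source is a product, its target is a product if and only if both squares are pushouts. -/
theorem nonempty_isLimit_binaryFan_iff_isPushout {P A B P' A' B' : CommRingCat.{u}}
    {p : P ⟶ A} {q : P ⟶ B} (hpq : IsLimit (BinaryFan.mk p q)) {p' : P' ⟶ A'} {q' : P' ⟶ B'}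
    {α : A ⟶ A'} {β : B ⟶ B'} {f : P ⟶ P'} (hα : p ≫ α = f ≫ p') (hβ : q ≫ β = f ≫ q') :
    Nonempty (IsLimit (BinaryFan.mk p' q')) ↔ IsPushout p f α p' ∧ IsPushout q f β q' := by
  have hbij := (nonempty_isLimit_binaryFan_iff p q).mp ⟨hpq⟩
  obtain ⟨e, he⟩ := hbij.surjective (1, 0)
  have hp : p.hom e = 1 := congrArg Prod.fst he
  have hq : q.hom e = 0 := congrArg Prod.snd he
  have hidem : IsIdempotentElem e := hbij.injective (by simp [hp, hq])
  obtain ⟨⟨hps, hpk⟩, ⟨hqs, hqk⟩⟩ :=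
    (RingHom.bijective_prod_iff_of_isIdempotentElem _ _ hidem hp hq).mp hbij
  have hp' : p'.hom (f.hom e) = 1 := by
    rw [← RingHom.comp_apply, ← hom_comp, ← hα, hom_comp, RingHom.comp_apply, hp, map_one]
  have hq' : q'.hom (f.hom e) = 0 := by
    rw [← RingHom.comp_apply, ← hom_comp, ← hβ, hom_comp, RingHom.comp_apply, hq, map_zero]
  rw [nonempty_isLimit_binaryFan_iff, isPushout_iff_of_surjective hα hps,
    isPushout_iff_of_surjective hβ hqs, hpk, hqk, Ideal.map_span, Ideal.map_span,
    Set.image_singleton, Set.image_singleton, map_sub, map_one]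
  exact RingHom.bijective_prod_iff_of_isIdempotentElem _ _ (hidem.map f.hom) hp' hq'

theorem finitaryExtensive_op : FinitaryExtensive (CommRingCat.{u})ᵒᵖ where
  van_kampen' {X Y} c hc := by
    rw [BinaryCofan.isVanKampen_iff]
    intro X' Y' c' αX αY f hX hY
    have hunop : Nonempty (IsColimit c') ↔
        Nonempty (IsLimit (BinaryFan.mk c'.inl.unop c'.inr.unop)) :=
      ⟨fun ⟨h⟩ ↦ ⟨BinaryCofan.IsColimit.unop h⟩, fun ⟨h⟩ ↦
        ⟨(BinaryFan.IsLimit.op h).ofIsoColimit (isoBinaryCofanMk c').symm⟩⟩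
    exact hunop.trans <|
      (nonempty_isLimit_binaryFan_iff_isPushout (BinaryCofan.IsColimit.unop hc)
        (congrArg Quiver.Hom.unop hX) (congrArg Quiver.Hom.unop hY)).trans <|
      and_congr IsPushout.unop_iff IsPushout.unop_iff

end CommRingCat

/-- The opposite of the category of commutative rings is finitary extensive and has a
terminal object, given by the ring `ℤ` (which is initial in `CommRingCat`). -/
theorem stmt14 :
    FinitaryExtensive (CommRingCat.{u})ᵒᵖ ∧
    Nonempty (Limits.IsTerminal (Opposite.op (CommRingCat.of (ULift.{u} ℤ)))) :=
  ⟨CommRingCat.finitaryExtensive_op, ⟨Limits.terminalOpOfInitial CommRingCat.isInitial⟩⟩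
end

section
/- Let C be a finitary extensive category with a terminal object 1. Let m : S ⟶ X be a monomorphism complemented by m' : S' ⟶ X (i.e. [m, m'] : S ⨿ S' ⟶ X is an isomorphism), and let ε : S ⟶ X ⨿ 1 be the composite of m with the first coproduct injection κ₁ : X ⟶ X ⨿ 1. Then: (i) the square with top κ₁ : S ⟶ S ⨿ 1, left 𝟙_S, right m ⨿ 𝟙_1 : S ⨿ 1 ⟶ X ⨿ 1, and bottom ε is a pullback; and (ii) for every morphism f : Y ⟶ X ⨿ 1 such that there is a morphism u : Y ⟶ S ⨿ 1 making the square with top u, left 𝟙_Y, right m ⨿ 𝟙_1, bottom f a pullback, there is a unique morphism f̄ : Y ⟶ S ⨿ 1 with (m ⨿ 𝟙_1) ∘ f̄ = f. -/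
open CategoryTheory CategoryTheory.Limits

/-- In a category whose coproduct injections are monic, if `m` is complemented then
`m ⨿ 𝟙` is monic, since it is itself a coproduct injection up to isomorphism. -/
theorem mono_coprod_map_id_of_isIso_desc {C : Type*} [Category* C] [HasBinaryCoproducts C]
    [MonoCoprod C] {S S' X : C} (T : C) (m : S ⟶ X) (m' : S' ⟶ X)
    [IsIso (coprod.desc m m')] : Mono (coprod.map m (𝟙 T)) := by
  have hm : m ≫ inv (coprod.desc m m') = coprod.inl := by
    rw [IsIso.comp_inv_eq, coprod.inl_desc]
  let g : X ⨿ T ⟶ (S ⨿ T) ⨿ S' :=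
    coprod.desc (inv (coprod.desc m m') ≫ coprod.desc (coprod.inl ≫ coprod.inl) coprod.inr)
      (coprod.inr ≫ coprod.inl)
  have hg : coprod.map m (𝟙 T) ≫ g = coprod.inl := by
    ext
    · simp [g, reassoc_of% hm, coprod.inl_desc]
    · simp [g, coprod.inr_desc]
  exact mono_of_mono_fac hg

/-- A factorization `u ≫ p = f` through a monomorphism `p` exhibits the pullback of `p` along
`f` as the whole domain of `f`. -/
theorem isPullback_id_of_mono {C : Type*} [Category* C] {Y A B : C} {u : Y ⟶ A} {p : A ⟶ B}
    {f : Y ⟶ B} [Mono p] (w : u ≫ p = f) : IsPullback u (𝟙 Y) p f :=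
  ⟨⟨by simpa using w⟩, ⟨PullbackCone.IsLimit.mk _ (fun s ↦ s.snd)
    (fun s ↦ by rw [← cancel_mono p, Category.assoc, w, s.condition])
    (fun s ↦ Category.comp_id _)
    (fun s l _ hl ↦ by simpa using hl)⟩⟩

/-- The counit of the comprehension adjunction in a finitary extensive category with a
terminal object: for a complemented subobject `m : S ⟶ X`, the partial map
`ε = m ≫ κ₁ : S ⟶ X ⨿ 1` satisfies (i) pulling back `m ⨿ 𝟙` along `ε` gives all of `S`,
and (ii) every partial map `f : Y ⟶ X ⨿ 1` whose pullback of `m ⨿ 𝟙` is all of `Y`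
factors uniquely through `m ⨿ 𝟙`. -/
theorem stmt18 {C : Type u} [Category.{v} C] [FinitaryExtensive C] [HasTerminal C]
    {S S' X : C} (m : S ⟶ X) (m' : S' ⟶ X) [Mono m] [Mono m']
    (hc : IsIso (coprod.desc m m')) :
    IsPullback (coprod.inl : S ⟶ S ⨿ ⊤_ C) (𝟙 S) (coprod.map m (𝟙 (⊤_ C)))
        (m ≫ coprod.inl) ∧
    ∀ (Y : C) (f : Y ⟶ X ⨿ ⊤_ C),
      (∃ u : Y ⟶ S ⨿ ⊤_ C, IsPullback u (𝟙 Y) (coprod.map m (𝟙 (⊤_ C))) f) →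
      ∃! fbar : Y ⟶ S ⨿ ⊤_ C, fbar ≫ coprod.map m (𝟙 (⊤_ C)) = f := by
  have : Mono (coprod.map m (𝟙 (⊤_ C))) := mono_coprod_map_id_of_isIso_desc _ m m'
  refine ⟨isPullback_id_of_mono (by simp), ?_⟩
  rintro Y f ⟨u, hu⟩
  have w : u ≫ coprod.map m (𝟙 (⊤_ C)) = f := by simpa using hu.w
  exact ⟨u, w, fun v hv ↦ by rw [← cancel_mono (coprod.map m (𝟙 (⊤_ C))), hv, w]⟩
end

section
/- Let C be a finitary extensive category with a terminal object 1. Let m : S ⟶ X be a monomorphism complemented by m' : S' ⟶ X, with i : X ⟶ S' ⨿ S the inverse of the isomorphism [m', m] : S' ⨿ S ⟶ X, and let η : X ⟶ S' ⨿ 1 be the composite (𝟙_{S'} ⨿ !_S) ∘ i, where !_S : S ⟶ 1 is the unique morphism to the terminal object. Then: (i) the square with top !_S : S ⟶ 1, left m : S ⟶ X, right the second coproduct injection κ₂ : 1 ⟶ S' ⨿ 1, and bottom η is a pullback; and (ii) for every morphism f : X ⟶ Y ⨿ 1 with f ∘ m = κ₂ ∘ !_S (where κ₂ : 1 ⟶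 Y ⨿ 1), there is a unique morphism f̄ : S' ⟶ Y ⨿ 1 with [f̄, κ₂] ∘ η = f. -/
open CategoryTheory CategoryTheory.Limits

/-- In a finitary extensive category, the naturality square of the second coproduct injection
is a pullback. -/
lemma isPullback_inr_coprod_map {C : Type*} [Category* C] [FinitaryExtensive C]
    {A B A' B' : C} (f : A ⟶ A') (g : B ⟶ B') :
    IsPullback g (coprod.inr : B ⟶ A ⨿ B) (coprod.inr : B' ⟶ A' ⨿ B') (coprod.map f g) := by
  have h := (BinaryCofan.isVanKampen_iff _).mp
    (FinitaryExtensive.vanKampen _ (coprodIsCoprod A' B'))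
    (BinaryCofan.mk (coprod.inl : A ⟶ A ⨿ B) coprod.inr) f g (coprod.map f g)
    (coprod.inl_map f g).symm (coprod.inr_map f g).symm
  exact (h.mp ⟨coprodIsCoprod A B⟩).2.flip

/-- The unit of the quotient adjunction in a finitary extensive category with a terminal
object: for a subobject `m : S ⟶ X` complemented by `m' : S' ⟶ X`, the partial map
`η = (𝟙 ⨿ !) ∘ [m', m]⁻¹ : X ⟶ S' ⨿ 1` satisfies (i) the square with top `!_S`, left `m`,
right `κ₂` and bottom `η` is a pullback, and (ii) every partial map `f : X ⟶ Y ⨿ 1`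
killing `m` factors uniquely through `η` as `f = [f̄, κ₂] ∘ η`. -/
theorem stmt19 {C : Type u} [Category.{v} C] [FinitaryExtensive C] [HasTerminal C]
    {S S' X : C} (m : S ⟶ X) (m' : S' ⟶ X) [Mono m] [Mono m']
    [IsIso (coprod.desc m' m)] :
    IsPullback (terminal.from S) m (coprod.inr : ⊤_ C ⟶ S' ⨿ ⊤_ C)
        (inv (coprod.desc m' m) ≫ coprod.map (𝟙 S') (terminal.from S)) ∧
    ∀ (Y : C) (f : X ⟶ Y ⨿ ⊤_ C),
      m ≫ f = terminal.from S ≫ (coprod.inr : ⊤_ C ⟶ Y ⨿ ⊤_ C) →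
      ∃! fbar : S' ⟶ Y ⨿ ⊤_ C,
        (inv (coprod.desc m' m) ≫ coprod.map (𝟙 S') (terminal.from S)) ≫
          coprod.desc fbar coprod.inr = f := by
  refine ⟨(isPullback_inr_coprod_map (𝟙 S') (terminal.from S)).of_iso (Iso.refl _) (Iso.refl _)
    (asIso (coprod.desc m' m)) (Iso.refl _) (by simp) (by simp [coprod.inr_desc])
    (by simp) (by simp), ?_⟩
  intro Y f hf
  simp only [Category.assoc, IsIso.inv_comp_eq]
  refine ⟨m' ≫ f, ?_, fun g hg => ?_⟩
  · ext <;> simp [hf]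
  · simpa [coprod.inl_desc] using coprod.inl ≫= hg
end
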